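/- For n ≥ 1 data points x_1,…,x_n ∈ ℝ^p, let M = Σ_i [1, x_i][1, x_i]ᵀ be the (p+1)×(p+1) information matrix of the linear model with intercept. Then det(M) ≤ 4 (n/4)^{p+1} Π_{j=1}^p (max_i x_{ij} - min_i x_{ij})². -/

import Mathlib

open Matrix

/-- **Hadamard's inequality**: the determinant of a real positive semidefinite matrix is at most the
product of its diagonal entries. -/
theorem Matrix.PosSemidef.det_le_prod_diag {m : ℕ} {A : Matrix (Fin m) (Fin m) ℝ}
    (hA : A.PosSemidef) : A.det ≤ ∏ i, A i i := by
  obtain ⟨B, rfl⟩ : ∃ B : Matrix (Fin m) (Fin m) ℝ, A = Bᴴ * B := by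
    open scoped MatrixOrder in
    exact CStarAlgebra.nonneg_iff_eq_star_mul_self.mp hA.nonneg
  have : Fact (Module.finrank ℝ (EuclideanSpace ℝ (Fin m)) = m) := ⟨by simp⟩
  let b := EuclideanSpace.basisFun (Fin m) ℝ
  have h := b.toBasis.orientation.abs_volumeForm_apply_le
    (fun j => WithLp.toLp 2 (fun i => B i j))
  rw [Orientation.volumeForm_robust _ b rfl, Module.Basis.det_apply] at h
  have hB : b.toBasis.toMatrix (fun j => WithLp.toLp 2 (fun i => B i j)) = B := by
    ext i j
    simp [b, Module.Basis.toMatrix_apply]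
  rw [hB] at h
  calc (Bᴴ * B).det = |B.det| ^ 2 := by simp [det_mul, sq]
    _ ≤ (∏ j, ‖WithLp.toLp 2 (fun i => B i j)‖) ^ 2 := by gcongr
    _ = ∏ j, (Bᴴ * B) j j := by
      rw [← Finset.prod_pow]
      simp [EuclideanSpace.norm_sq_eq, mul_apply, ← sq]

/-- Adding multiples `w k` of the column `k₀` to the columns `k ≠ k₀` of a matrix does not change
its Gram determinant. -/
theorem Matrix.det_gram_add_smul_col {ι κ : Type*} [Fintype ι] [Fintype κ] [DecidableEq κ]
    (X : Matrix ι κ ℝ) (k₀ : κ) (w : κ → ℝ) (hw : w k₀ = 0) :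
    ((X + vecMulVec (X.col k₀) w)ᵀ * (X + vecMulVec (X.col k₀) w)).det = (Xᵀ * X).det := by
  have hX : X + vecMulVec (X.col k₀) w = X * (1 + vecMulVec (Pi.single k₀ 1) w) := by
    rw [Matrix.mul_add, Matrix.mul_one, mul_vecMulVec, mulVec_single_one]
  have hT : (1 + vecMulVec (Pi.single k₀ 1) w).det = 1 := by
    rw [vecMulVec_eq Unit, det_one_add_replicateCol_mul_replicateRow]
    simp [hw]
  rw [hX, transpose_mul, Matrix.mul_assoc, ← Matrix.mul_assoc Xᵀ, det_mul, det_mul, det_transpose,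
    hT, one_mul, mul_one]

/-- IBOSS determinant upper bound: det M ≤ 4 (n/4)^{p+1} Π_j (range of x_j)². -/
theorem stmt_9 (n p : ℕ) [NeZero n] (x : Fin n → Fin p → ℝ)
    (M : Matrix (Fin (p + 1)) (Fin (p + 1)) ℝ)
    (hM : M = ∑ i, Matrix.vecMulVec (Fin.cons (1 : ℝ) (x i)) (Fin.cons (1 : ℝ) (x i))) :
    M.det ≤ 4 * ((n : ℝ) / 4) ^ (p + 1) *
      ∏ j : Fin p,
        (Finset.univ.sup' Finset.univ_nonempty (fun i => x i j)
          - Finset.univ.inf' Finset.univ_nonempty (fun i => x i j)) ^ 2 := by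
  set hi : Fin p → ℝ := fun j => Finset.univ.sup' Finset.univ_nonempty (fun i => x i j)
  set lo : Fin p → ℝ := fun j => Finset.univ.inf' Finset.univ_nonempty (fun i => x i j)
  have hx_le (i j) : x i j ≤ hi j := Finset.le_sup' (fun i => x i j) (Finset.mem_univ i)
  have hle_x (i j) : lo j ≤ x i j := Finset.inf'_le (fun i => x i j) (Finset.mem_univ i)
  let X : Matrix (Fin n) (Fin (p + 1)) ℝ := of fun i => Fin.cons 1 (x i)
  -- Subtracting the midrange from every covariate bounds it by half its range.
  let w : Fin (p + 1) → ℝ := Fin.cons 0 fun j => -((hi j + lo j) / 2)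
  let Z := X + vecMulVec (X.col 0) w
  have hMX : M = Xᵀ * X := by
    ext a b
    simp [hM, X, Matrix.sum_apply, vecMulVec_apply, mul_apply]
  have hdiag_zero : (Zᵀ * Z) 0 0 = n := by
    simp [Z, X, w, mul_apply, vecMulVec_apply]
  have hdiag_succ (j : Fin p) : (Zᵀ * Z) j.succ j.succ ≤ n / 4 * (hi j - lo j) ^ 2 := by
    calc (Zᵀ * Z) j.succ j.succ = ∑ i, (x i j - (hi j + lo j) / 2) ^ 2 := by
          simp [Z, X, w, mul_apply, vecMulVec_apply, sq, sub_eq_add_neg]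
      _ ≤ ∑ _i : Fin n, (hi j - lo j) ^ 2 / 4 :=
          Finset.sum_le_sum fun i _ => by nlinarith [hx_le i j, hle_x i j]
      _ = n / 4 * (hi j - lo j) ^ 2 := by
          simp only [Finset.sum_const, Finset.card_univ, Fintype.card_fin, nsmul_eq_mul]
          ring
  have hpsd : (Zᵀ * Z).PosSemidef := by
    simpa using posSemidef_conjTranspose_mul_self Z
  calc M.det = (Zᵀ * Z).det := by rw [hMX, det_gram_add_smul_col X 0 w (by simp [w])]
    _ ≤ ∏ k, (Zᵀ * Z) k k := hpsd.det_le_prod_diag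
    _ = n * ∏ j : Fin p, (Zᵀ * Z) j.succ j.succ := by rw [Fin.prod_univ_succ, hdiag_zero]
    _ ≤ n * ∏ j : Fin p, (n / 4 * (hi j - lo j) ^ 2) := by
        gcongr with j
        · exact fun j _ => hpsd.diag_nonneg
        · exact hdiag_succ j
    _ = 4 * ((n : ℝ) / 4) ^ (p + 1) * ∏ j : Fin p, (hi j - lo j) ^ 2 := by
        rw [Finset.prod_mul_distrib, Finset.prod_const, Finset.card_univ, Fintype.card_fin]
        ring
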